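/- arXiv:2108.12796 — 2 statements merged into one kernel-verified Lean document; each statement's English description precedes it below -/
import Mathlib

section
/- 48/π = ∑_{n=0}^∞ (1/16^n) · [(1/2)_n (1/4)_n (3/4)_n (1/8)_n (5/8)_n / ((1)_n³ (7/8)_n (11/8)_n)] · (480n² + 212n + 15). -/
open Real

/-- Pochhammer symbol (x)_n = x (x+1) ⋯ (x+n-1). -/
noncomputable def poch (x : ℝ) (n : ℕ) : ℝ :=
  ∏ k ∈ Finset.range n, (x + k)

lemma poch_succ' (x : ℝ) (k : ℕ) : poch x (k + 1) = poch x k * (x + k) := by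
  simp [poch, Finset.prod_range_succ]

lemma poch_pos' {x : ℝ} (hx : 0 < x) (k : ℕ) : 0 < poch x k := by
  unfold poch
  exact Finset.prod_pos fun i _ => by positivity

lemma poch_mono' {x y : ℝ} (hx : 0 < x) (hxy : x ≤ y) (k : ℕ) : poch x k ≤ poch y k := by
  unfold poch
  exact Finset.prod_le_prod (fun i _ => by positivity) (fun i _ => by linarith)

lemma poch_shift' (x : ℝ) (k : ℕ) : poch (x + 1) k * x = poch x k * (x + k) := by
  induction k with
  | zero => simp [poch]
  | succ k ih =>
    rw [poch_succ', poch_succ']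
    push_cast
    linear_combination (x + 1 + k) * ih

lemma poch_shift_eq {x : ℝ} (hx : 0 < x) (k : ℕ) : poch (x + 1) k = poch x k * (x + k) / x := by
  rw [eq_div_iff hx.ne']
  exact poch_shift' x k

/-- the hypergeometric coefficient of the series -/
noncomputable def tt (n : ℕ) : ℝ := (1 / 16 ^ n) *
      (poch (1/2) n * poch (1/4) n * poch (3/4) n * poch (1/8) n * poch (5/8) n /
        (poch 1 n ^ 3 * poch (7/8) n * poch (11/8) n))

noncomputable def ss (n k : ℕ) : ℝ :=
  poch (1/2 + n) k * poch (1/2) k * poch (3/4) k /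
    (poch (1 + n) k * poch (2 + 2 * n) k * poch (7/4 + 2 * n) k)

noncomputable def PP (n k : ℕ) : ℝ :=
  ((480 * (n : ℝ)^2 + 212 * n + 15) * (2 * n + 1) + (78 + 648 * n + 1088 * (n : ℝ)^2) * k
    + (128 + 448 * n) * (k : ℝ)^2 + 64 * (k : ℝ)^3) / (2 * n + 1)

noncomputable def GG (n k : ℕ) : ℝ := tt n * ss n k * PP n k

noncomputable def FF (n k : ℕ) : ℝ :=
  64 * tt n * n * ss n k * (1 + 2 * n + k) * (8 * n + 4 * k + 3) / (1 + 2 * n)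

lemma tt_pos (n : ℕ) : 0 < tt n := by
  have h1 := poch_pos' (x := 1/2) (by norm_num) n
  have h2 := poch_pos' (x := 1/4) (by norm_num) n
  have h3 := poch_pos' (x := 3/4) (by norm_num) n
  have h4 := poch_pos' (x := 1/8) (by norm_num) n
  have h5 := poch_pos' (x := 5/8) (by norm_num) n
  have h6 := poch_pos' (x := 1) (by norm_num) n
  have h7 := poch_pos' (x := 7/8) (by norm_num) n
  have h8 := poch_pos' (x := 11/8) (by norm_num) n
  unfold tt
  positivity

lemma ss_pos (n k : ℕ) : 0 < ss n k := by
  have h1 := poch_pos' (x := 1/2 + n) (by positivity) k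
  have h2 := poch_pos' (x := 1/2) (by norm_num) k
  have h3 := poch_pos' (x := 3/4) (by norm_num) k
  have h4 := poch_pos' (x := 1 + n) (by positivity) k
  have h5 := poch_pos' (x := 2 + 2 * n) (by positivity) k
  have h6 := poch_pos' (x := 7/4 + 2 * n) (by positivity) k
  unfold ss
  positivity

lemma PP_pos (n k : ℕ) : 0 < PP n k := by
  unfold PP
  positivity

lemma tt_succ (n : ℕ) : tt (n + 1) = tt n *
    ((1/2 + n) * (1/4 + n) * (3/4 + n) * (1/8 + n) * (5/8 + n) /
      (16 * (1 + n)^3 * (7/8 + n) * (11/8 + n))) := by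
  have h6 := (poch_pos' (x := 1) (by norm_num) n).ne'
  have h7 := (poch_pos' (x := 7/8) (by norm_num) n).ne'
  have h8 := (poch_pos' (x := 11/8) (by norm_num) n).ne'
  unfold tt
  simp only [poch_succ', pow_succ (16 : ℝ)]
  generalize poch 1 n = a at *
  generalize poch (7/8) n = b at *
  generalize poch (11/8) n = c at *
  field_simp

lemma ss_succ_right (n k : ℕ) : ss n (k + 1) = ss n k *
    ((1/2 + n + k) * (1/2 + k) * (3/4 + k) /
      ((1 + n + k) * (2 + 2 * n + k) * (7/4 + 2 * n + k))) := by
  unfold ss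
  simp only [poch_succ']
  rw [div_mul_div_comm]
  congr 1 <;> ring

lemma ss_succ_left (n k : ℕ) : ss (n + 1) k = ss n k *
    (((1/2 + n + k) / (1/2 + n)) * ((1 + n) / (1 + n + k)) *
     ((2 + 2 * n) * (3 + 2 * n) / ((2 + 2 * n + k) * (3 + 2 * n + k))) *
     ((7/4 + 2 * n) * (11/4 + 2 * n) / ((7/4 + 2 * n + k) * (11/4 + 2 * n + k)))) := by
  have e1 : poch (1/2 + ((n + 1 : ℕ) : ℝ)) k = poch (1/2 + n) k * (1/2 + n + k) / (1/2 + n) := by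
    rw [← poch_shift_eq (by positivity)]; push_cast; ring_nf
  have e2 : poch (1 + ((n + 1 : ℕ) : ℝ)) k = poch (1 + n) k * (1 + n + k) / (1 + n) := by
    rw [← poch_shift_eq (by positivity)]; push_cast; ring_nf
  have e3 : poch (2 + 2 * ((n + 1 : ℕ) : ℝ)) k =
      poch (2 + 2 * n) k * (2 + 2 * n + k) / (2 + 2 * n) * (2 + 2 * n + 1 + k) / (2 + 2 * n + 1) := by
    rw [← poch_shift_eq (by positivity), ← poch_shift_eq (by positivity)]; push_cast; ring_nf
  have e4 : poch (7/4 + 2 * ((n + 1 : ℕ) : ℝ)) k =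
      poch (7/4 + 2 * n) k * (7/4 + 2 * n + k) / (7/4 + 2 * n) * (7/4 + 2 * n + 1 + k)
        / (7/4 + 2 * n + 1) := by
    rw [← poch_shift_eq (by positivity), ← poch_shift_eq (by positivity)]; push_cast; ring_nf
  have h4 := (poch_pos' (x := 1 + n) (by positivity) k).ne'
  have h5 := (poch_pos' (x := 2 + 2 * n) (by positivity) k).ne'
  have h6 := (poch_pos' (x := 7/4 + 2 * n) (by positivity) k).ne'
  unfold ss
  rw [e1, e2, e3, e4]
  generalize poch (1 + n) k = a at *
  generalize poch (2 + 2 * n) k = b at *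
  generalize poch (7/4 + 2 * n) k = c at *
  generalize poch (1/2 + n) k = d at *
  generalize poch (1/2) k = e at *
  generalize poch (3/4) k = f at *
  have : (11/4 + 2 * (n:ℝ)) = 7/4 + 2 * n + 1 := by ring
  rw [this]
  have : (11/4 + 2 * (n:ℝ) + k) = 7/4 + 2 * n + 1 + k := by ring
  have : (3 + 2 * (n:ℝ)) = 2 + 2 * n + 1 := by ring
  rw [this]
  field_simp

lemma wz (n k : ℕ) : GG n (k + 1) - GG n k = FF (n + 1) k - FF n k := by
  unfold GG FF PP
  rw [ss_succ_right, ss_succ_left, tt_succ]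
  generalize tt n = t
  generalize ss n k = s
  push_cast
  have hn : (0 : ℝ) ≤ n := n.cast_nonneg
  have hk : (0 : ℝ) ≤ k := k.cast_nonneg
  generalize (n : ℝ) = x at *
  generalize (k : ℝ) = y at *
  have h1 : 1 + 2 * (x + 1) ≠ 0 := by positivity
  field_simp
  ring

lemma tt_le (n : ℕ) : tt n ≤ (1/16) ^ n := by
  induction n with
  | zero => simp [tt, poch]
  | succ n ih =>
    rw [tt_succ, pow_succ (1/16 : ℝ)]
    have hn : (0 : ℝ) ≤ n := n.cast_nonneg
    refine mul_le_mul ih ?_ (by positivity) (by positivity)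
    rw [div_le_div_iff₀ (by positivity) (by norm_num)]
    have : (1/2 + (n:ℝ)) * (1/4 + n) * (3/4 + n) * (1/8 + n) * (5/8 + n) ≤
      (1 + n) * (1 + n) * (1 + n) * (7/8 + n) * (11/8 + n) := by
      gcongr <;> norm_num
    linarith

lemma ss_le_one (n k : ℕ) : ss n k ≤ 1 := by
  have hn : (0 : ℝ) ≤ n := n.cast_nonneg
  have h1 := poch_pos' (x := 1/2 + n) (by positivity) k
  have h2 := poch_pos' (x := 1/2) (by norm_num) k
  have h3 := poch_pos' (x := 3/4) (by norm_num) k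
  have h4 := poch_pos' (x := 1 + n) (by positivity) k
  have h5 := poch_pos' (x := 2 + 2 * n) (by positivity) k
  have h6 := poch_pos' (x := 7/4 + 2 * n) (by positivity) k
  unfold ss
  rw [div_le_one (by positivity)]
  have g1 := poch_mono' (x := 1/2 + n) (y := 1 + n) (by positivity) (by linarith) k
  have g2 := poch_mono' (x := 1/2) (y := 2 + 2 * n) (by positivity) (by linarith) k
  have g3 := poch_mono' (x := 3/4) (y := 7/4 + 2 * n) (by positivity) (by linarith) k
  gcongr

lemma ss_le (n k : ℕ) (h : 1 ≤ n) : ss n k ≤ 6 / ((k + 1 : ℝ) * (k + 2) * (k + 3)) * (1 / (k + 1)) := by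
  have hn : (1 : ℝ) ≤ n := by exact_mod_cast h
  have h1 := poch_pos' (x := 1/2 + n) (by positivity) k
  have h2 := poch_pos' (x := 1/2) (by norm_num) k
  have h3 := poch_pos' (x := 3/4) (by norm_num) k
  have h4 := poch_pos' (x := 1 + n) (by positivity) k
  have h5 := poch_pos' (x := 2 + 2 * n) (by positivity) k
  have h6 := poch_pos' (x := 7/4 + 2 * n) (by positivity) k
  have h7 := poch_pos' (x := 1) (by norm_num) k
  have g1 := poch_mono' (x := 1/2 + n) (y := 1 + n) (by positivity) (by linarith) k
  have g2 : poch (1/2) k ≤ poch 1 k := poch_mono' (by positivity) (by norm_num) k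
  have g3 : poch 4 k ≤ poch (2 + 2 * n) k := poch_mono' (by positivity) (by linarith) k
  have g4 : poch (7/4) k ≤ poch (7/4 + 2 * n) k := poch_mono' (by positivity) (by linarith) k
  have e1 : poch 4 k = poch 1 k * ((k + 1 : ℝ) * (k + 2) * (k + 3)) / 6 := by
    rw [show (4:ℝ) = 1 + 1 + 1 + 1 by norm_num, poch_shift_eq (by norm_num),
      poch_shift_eq (by norm_num), poch_shift_eq (by norm_num)]
    ring
  have e2 : poch (7/4) k = poch (3/4) k * (3/4 + k) / (3/4) := by
    rw [← poch_shift_eq (by norm_num)]; norm_num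
  have e3 : poch (3/4) k * (k + 1) ≤ poch (7/4 + 2 * n) k := by
    refine le_trans ?_ g4
    rw [e2, le_div_iff₀ (by norm_num)]
    have : (k + 1 : ℝ) * (3/4) ≤ 3/4 + k := by
      have : (0:ℝ) ≤ k := k.cast_nonneg
      linarith
    nlinarith
  have e4 : poch (1/2) k * ((k + 1 : ℝ) * (k + 2) * (k + 3)) ≤ 6 * poch (2 + 2 * n) k := by
    have : poch (1/2) k * ((k + 1 : ℝ) * (k + 2) * (k + 3)) ≤
      poch 1 k * ((k + 1 : ℝ) * (k + 2) * (k + 3)) := by gcongr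
    linarith
  unfold ss
  rw [div_mul_div_comm, div_le_div_iff₀ (by positivity) (by positivity)]
  calc _ = poch (1/2 + n) k * (poch (1/2) k * ((k + 1 : ℝ) * (k + 2) * (k + 3))) *
        (poch (3/4) k * (k + 1)) := by ring
    _ ≤ poch (1 + n) k * (6 * poch (2 + 2 * n) k) * poch (7/4 + 2 * n) k := by gcongr
    _ = _ := by ring

lemma nsq_le (n : ℕ) : ((n : ℝ) + 1)^2 ≤ 4 ^ n := by
  have h : n + 1 ≤ 2 ^ n := Nat.lt_two_pow_self
  have h' : (n : ℝ) + 1 ≤ 2 ^ n := by exact_mod_cast h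
  calc ((n : ℝ) + 1)^2 ≤ (2 ^ n)^2 := by gcongr
    _ = 4 ^ n := by rw [← pow_mul, mul_comm, pow_mul]; norm_num

lemma tt_sq_le (n : ℕ) : tt n * ((n : ℝ) + 1)^2 ≤ (1/4)^n := by
  calc tt n * ((n : ℝ) + 1)^2 ≤ (1/16)^n * 4^n := by
        gcongr
        · exact tt_le n
        · exact nsq_le n
    _ = _ := by rw [← mul_pow]; norm_num

lemma PP_le (n k : ℕ) : PP n k ≤ 1000 * ((n : ℝ) + 1)^2 * (k + 1)^3 := by
  unfold PP
  rw [div_le_iff₀ (by positivity)]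
  have hn : (0 : ℝ) ≤ n := n.cast_nonneg
  have hk : (0 : ℝ) ≤ k := k.cast_nonneg
  generalize (n : ℝ) = x at *
  generalize (k : ℝ) = y at *
  rw [← sub_nonneg]
  ring_nf
  positivity

lemma GG_nonneg (n k : ℕ) : 0 ≤ GG n k :=
  (mul_pos (mul_pos (tt_pos n) (ss_pos n k)) (PP_pos n k)).le

lemma GG_le (n k : ℕ) : GG n k ≤ 1000 * (k + 1)^3 * (1/4)^n := by
  unfold GG
  have h0 := tt_pos n
  have h1 := ss_pos n k
  have h2 := PP_pos n k
  calc tt n * ss n k * PP n k ≤ tt n * 1 * (1000 * ((n : ℝ) + 1)^2 * (k + 1)^3) := by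
        gcongr
        · exact ss_le_one n k
        · exact PP_le n k
    _ = 1000 * (k + 1)^3 * (tt n * ((n : ℝ) + 1)^2) := by ring
    _ ≤ _ := by
        gcongr
        exact tt_sq_le n

lemma GG_le' (n k : ℕ) (h : 1 ≤ n) : GG n k ≤ 6000 * (1/((k:ℝ) + 1)) * (1/4)^n := by
  unfold GG
  have h0 := tt_pos n
  have h1 := ss_pos n k
  have h2 := PP_pos n k
  calc tt n * ss n k * PP n k ≤ tt n * (6 / ((k + 1 : ℝ) * (k + 2) * (k + 3)) * (1 / (k + 1)))
          * (1000 * ((n : ℝ) + 1)^2 * (k + 1)^3) := by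
        gcongr
        · exact ss_le n k h
        · exact PP_le n k
    _ ≤ tt n * (6 / ((k + 1 : ℝ) * (k + 1) * (k + 1)) * (1 / (k + 1)))
          * (1000 * ((n : ℝ) + 1)^2 * (k + 1)^3) := by
        gcongr <;> norm_num
    _ = 6000 * (1/((k:ℝ) + 1)) * (tt n * ((n : ℝ) + 1)^2) := by
        field_simp
        norm_num
    _ ≤ _ := by
        gcongr
        exact tt_sq_le n

lemma FF_le (n k : ℕ) : FF n k ≤ 1000 * (k + 1)^2 * (1/4)^n := by
  have h0 := tt_pos n
  have h1 := ss_pos n k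
  unfold FF
  rw [div_le_iff₀ (by positivity)]
  calc 64 * tt n * n * ss n k * (1 + 2 * n + k) * (8 * n + 4 * k + 3)
      ≤ 64 * tt n * n * 1 * (1 + 2 * n + k) * (8 * n + 4 * k + 3) := by
        gcongr
        exact ss_le_one n k
    _ ≤ 1000 * (k + 1)^2 * (tt n * ((n : ℝ) + 1)^2) * (1 + 2 * n) := by
        have : (n : ℝ) * (1 + 2 * n + k) * (8 * n + 4 * k + 3) ≤
            8 * (k + 1)^2 * ((n : ℝ) + 1)^2 * (1 + 2 * n) := by
          have hn : (0 : ℝ) ≤ n := n.cast_nonneg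
          have hk : (0 : ℝ) ≤ k := k.cast_nonneg
          generalize (n : ℝ) = x at *
          generalize (k : ℝ) = y at *
          rw [← sub_nonneg]
          ring_nf
          positivity
        have h3 : (0:ℝ) ≤ 8 * (k + 1)^2 * ((n : ℝ) + 1)^2 * (1 + 2 * n) := by positivity
        have h4 := mul_le_mul_of_nonneg_left this (by positivity : 0 ≤ 64 * tt n)
        have h5 := mul_nonneg h0.le h3
        linarith
    _ ≤ _ := by
        gcongr
        exact tt_sq_le n

lemma FF_nonneg (n k : ℕ) : 0 ≤ FF n k := by
  have h0 := tt_pos n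
  have h1 := ss_pos n k
  unfold FF
  positivity

lemma geo_summable : Summable (fun n : ℕ => ((1:ℝ)/4)^n) :=
  summable_geometric_of_lt_one (by norm_num) (by norm_num)

lemma GG_summable (k : ℕ) : Summable (fun n => GG n k) :=
  Summable.of_nonneg_of_le (fun n => GG_nonneg n k) (fun n => GG_le n k) (geo_summable.mul_left _)

lemma FF_tendsto (k : ℕ) : Filter.Tendsto (fun n => FF n k) Filter.atTop (nhds 0) :=
  squeeze_zero (fun n => FF_nonneg n k) (fun n => FF_le n k)
    (geo_summable.mul_left _).tendsto_atTop_zero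

lemma tsum_GG_succ (k : ℕ) : ∑' n, GG n (k + 1) = ∑' n, GG n k := by
  have h1 := ((GG_summable (k+1)).hasSum.sub (GG_summable k).hasSum).tendsto_sum_nat
  have h2 : ∀ N, ∑ n ∈ Finset.range N, (GG n (k+1) - GG n k) = FF N k := by
    intro N
    simp_rw [wz]
    rw [Finset.sum_range_sub (fun n => FF n k)]
    simp [FF]
  simp_rw [h2] at h1
  have := tendsto_nhds_unique h1 (FF_tendsto k)
  linarith

lemma tsum_GG (k : ℕ) : ∑' n, GG n k = ∑' n, GG n 0 := by
  induction k with
  | zero => rfl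
  | succ k ih => rw [tsum_GG_succ, ih]

lemma ss_zero (k : ℕ) : ss 0 k = (Real.Wallis.W k)⁻¹ * (3 / ((2 * k + 1) * (k + 1) * (4 * k + 3))) := by
  induction k with
  | zero => simp [ss, poch, Real.Wallis.W]
  | succ k ih =>
    rw [ss_succ_right, ih, Real.Wallis.W_succ]
    have := (Real.Wallis.W_pos k).ne'
    generalize Real.Wallis.W k = w at *
    push_cast
    field_simp
    ring

lemma GG_zero_tendsto : Filter.Tendsto (fun k => GG 0 k) Filter.atTop (nhds (48 / π)) := by
  have hx : Filter.Tendsto (fun k : ℕ => 1 / ((k:ℝ) + 1)) Filter.atTop (nhds 0) :=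
    tendsto_one_div_add_atTop_nhds_zero_nat
  have hc : ContinuousAt (fun x : ℝ => 3 * (64 - 64 * x + 14 * x^2 + x^3) / ((2 - x) * (4 - x))) 0 := by
    refine ContinuousAt.div ?_ ?_ (by norm_num) <;> fun_prop
  have h1 := hc.tendsto.comp hx
  have h2 := (Real.Wallis.tendsto_W_nhds_pi_div_two.inv₀ (by positivity)).mul h1
  have e : (π / 2)⁻¹ * (3 * (64 - 64 * (0:ℝ) + 14 * 0^2 + 0^3) / ((2 - 0) * (4 - 0))) = 48 / π := by
    field_simp
    norm_num
  rw [e] at h2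
  refine h2.congr fun k => ?_
  simp only [Function.comp]
  unfold GG PP
  rw [ss_zero]
  have ht : tt 0 = 1 := by simp [tt, poch]
  rw [ht]
  have hk : (0 : ℝ) ≤ k := k.cast_nonneg
  generalize (k : ℝ) = y at *
  have a1 : 2 - 1 / (y + 1) = (2 * y + 1) / (y + 1) := by field_simp; ring
  have a2 : 4 - 1 / (y + 1) = (4 * y + 3) / (y + 1) := by field_simp; ring
  rw [a1, a2]
  have := (Real.Wallis.W_pos k).ne'
  generalize Real.Wallis.W k = w at *
  push_cast
  field_simp
  ring

lemma tail_tendsto : Filter.Tendsto (fun k => ∑' n, GG (n + 1) k) Filter.atTop (nhds 0) := by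
  have hx : Filter.Tendsto (fun k : ℕ => (1 / ((k:ℝ) + 1)) * ∑' n : ℕ, 6000 * ((1:ℝ)/4)^(n+1))
      Filter.atTop (nhds 0) := by
    simpa using (tendsto_one_div_add_atTop_nhds_zero_nat (𝕜 := ℝ)).mul_const
      (∑' n : ℕ, 6000 * ((1:ℝ)/4)^(n+1))
  refine squeeze_zero (fun k => tsum_nonneg fun n => GG_nonneg _ _) (fun k => ?_) hx
  have hs : Summable (fun n : ℕ => 6000 * ((1:ℝ)/4)^(n+1)) :=
    ((summable_nat_add_iff 1).2 geo_summable).mul_left _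
  rw [← tsum_mul_left]
  refine Summable.tsum_le_tsum (fun n => ?_) ((summable_nat_add_iff 1).2 (GG_summable k))
    (hs.mul_left _)
  have := GG_le' (n + 1) k (by omega)
  linarith

theorem series_48_div_pi :
    (48 : ℝ) / π = ∑' n : ℕ, (1 / 16 ^ n) *
      (poch (1/2) n * poch (1/4) n * poch (3/4) n * poch (1/8) n * poch (5/8) n /
        (poch 1 n ^ 3 * poch (7/8) n * poch (11/8) n)) *
      (480 * (n : ℝ) ^ 2 + 212 * n + 15) := by
  have h1 : ∀ n : ℕ, (1 / 16 ^ n) *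
      (poch (1/2) n * poch (1/4) n * poch (3/4) n * poch (1/8) n * poch (5/8) n /
        (poch 1 n ^ 3 * poch (7/8) n * poch (11/8) n)) *
      (480 * (n : ℝ) ^ 2 + 212 * n + 15) = GG n 0 := by
    intro n
    have : ss n 0 = 1 := by simp [ss, poch]
    have hp : PP n 0 = 480 * (n : ℝ) ^ 2 + 212 * n + 15 := by
      unfold PP
      have : (2 * (n:ℝ) + 1) ≠ 0 := by positivity
      field_simp
      simp
    rw [GG, this, hp, mul_one, tt]
  simp_rw [h1]
  have h2 := GG_zero_tendsto.add tail_tendsto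
  rw [add_zero] at h2
  have h3 : ∀ k, GG 0 k + ∑' n, GG (n + 1) k = ∑' n, GG n 0 := by
    intro k
    rw [← tsum_GG k, (GG_summable k).tsum_eq_zero_add]
  simp_rw [h3] at h2
  exact tendsto_nhds_unique h2 tendsto_const_nhds
end

section
/- 15√3/π = ∑_{n=0}^∞ (1/16^n) · [(1/2)_n (1/3)_n² (2/3)_n² / ((1)_n³ (11/12)_n (17/12)_n)] · (135n² + 75n + 8). -/
open Real

namespace WZ

open Filter Topology Finset

lemma poch_zero (x : ℝ) : poch x 0 = 1 := by simp [poch]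

lemma poch_succ (x : ℝ) (n : ℕ) : poch x (n + 1) = poch x n * (x + n) := by
  simp [poch, Finset.prod_range_succ]

lemma poch_pos {x : ℝ} (hx : 0 < x) (n : ℕ) : 0 < poch x n := by
  unfold poch
  exact Finset.prod_pos fun k _ => by positivity

lemma poch_double (x : ℝ) (n : ℕ) :
    poch x (2 * n) = 4 ^ n * poch (x / 2) n * poch ((x + 1) / 2) n := by
  induction n with
  | zero => simp [poch_zero]
  | succ n ih =>
    rw [show 2 * (n + 1) = 2 * n + 1 + 1 by ring, poch_succ, poch_succ, ih, poch_succ, poch_succ]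
    push_cast
    ring

lemma poch_shift (x : ℝ) (n : ℕ) : x * poch (x + 1) n = poch x n * (x + n) := by
  induction n with
  | zero => simp [poch_zero]
  | succ n ih =>
    rw [poch_succ, ← mul_assoc, ih, poch_succ]
    push_cast
    ring

/-- The hypergeometric kernel of the WZ pair. -/
noncomputable def H (n k : ℕ) : ℝ :=
  poch (1/3) (2 * n + k) * poch (1/3) n ^ 2 * poch (1/2) (n + k) ^ 2 * poch (2/3) (n + k)
      * poch (1/2) n /
    (poch 1 (2 * n + k) ^ 2 * poch 1 n * poch (7/6) (n + k) * poch (11/6) (2 * n + k))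

noncomputable def P (n k : ℝ) : ℝ :=
  8 + 74 * k + 263 * k ^ 2 + 447 * k ^ 3 + 360 * k ^ 4 + 108 * k ^ 5
  + n * (155 + 1102 * k + 2727 * k ^ 2 + 2862 * k ^ 3 + 1080 * k ^ 4)
  + n ^ 2 * (1109 + 5481 * k + 8478 * k ^ 2 + 4212 * k ^ 3)
  + n ^ 3 * (3642 + 11196 * k + 8208 * k ^ 2)
  + n ^ 4 * (5580 + 8100 * k) + 3240 * n ^ 5

noncomputable def Q (n k : ℝ) : ℝ :=
  n * (45 + 234 * k + 216 * k ^ 2 + 378 * n + 756 * n * k + 648 * n ^ 2)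

noncomputable def F (n k : ℕ) : ℝ := H n k * (P n k / (1 + 2 * n + k) ^ 2)

noncomputable def G (n k : ℕ) : ℝ := H n k * Q n k

lemma H_pos (n k : ℕ) : 0 < H n k := by
  unfold H
  have h1 := poch_pos (x := 1/3) (by norm_num)
  have h2 := poch_pos (x := 1/2) (by norm_num)
  have h3 := poch_pos (x := 2/3) (by norm_num)
  have h4 := poch_pos (x := 1) (by norm_num)
  have h5 := poch_pos (x := 7/6) (by norm_num)
  have h6 := poch_pos (x := 11/6) (by norm_num)
  have := h1 (2*n+k)
  have := h1 n
  have := h2 (n+k)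
  have := h2 n
  have := h3 (n+k)
  have := h4 (2*n+k)
  have := h4 n
  have := h5 (n+k)
  have := h6 (2*n+k)
  positivity

lemma P_nonneg (n k : ℕ) : 0 ≤ P n k := by unfold P; positivity
lemma Q_nonneg (n k : ℕ) : 0 ≤ Q n k := by unfold Q; positivity
lemma F_nonneg (n k : ℕ) : 0 ≤ F n k := by
  have := P_nonneg n k
  have := H_pos n k
  unfold F; positivity
lemma G_nonneg (n k : ℕ) : 0 ≤ G n k := mul_nonneg (H_pos n k).le (Q_nonneg n k)

lemma H_succ_right (n k : ℕ) : H n (k + 1) = H n k *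
    ((1/3 + (2*n+k)) * (1/2 + (n+k)) ^ 2 * (2/3 + (n+k)) /
      ((1 + (2*n+k)) ^ 2 * (7/6 + (n+k)) * (11/6 + (2*n+k)))) := by
  unfold H
  rw [← add_assoc, ← add_assoc]
  simp only [poch_succ]
  rw [div_mul_div_comm]
  push_cast
  congr 1 <;> ring

lemma H_succ_left (n k : ℕ) : H (n + 1) k = H n k *
    ((1/3 + (2*n+k)) * (4/3 + (2*n+k)) * (1/3 + n) ^ 2 * (1/2 + (n+k)) ^ 2 * (2/3 + (n+k))
        * (1/2 + n) /
      ((1 + (2*n+k)) ^ 2 * (2 + (2*n+k)) ^ 2 * (1 + n) * (7/6 + (n+k)) * (11/6 + (2*n+k))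
        * (17/6 + (2*n+k)))) := by
  unfold H
  rw [show 2 * (n + 1) + k = 2 * n + k + 1 + 1 by ring, show n + 1 + k = n + k + 1 by ring]
  simp only [poch_succ]
  rw [div_mul_div_comm]
  push_cast
  congr 1 <;> ring

lemma wz_rat (n k : ℝ) (hn : 0 ≤ n) (hk : 0 ≤ k) :
    ((1/3 + (2*n+k)) * (1/2 + (n+k)) ^ 2 * (2/3 + (n+k)) /
      ((1 + (2*n+k)) ^ 2 * (7/6 + (n+k)) * (11/6 + (2*n+k)))) *
        (P n (k+1) / (1 + 2 * n + (k+1)) ^ 2) - P n k / (1 + 2 * n + k) ^ 2 =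
    ((1/3 + (2*n+k)) * (4/3 + (2*n+k)) * (1/3 + n) ^ 2 * (1/2 + (n+k)) ^ 2 * (2/3 + (n+k))
        * (1/2 + n) /
      ((1 + (2*n+k)) ^ 2 * (2 + (2*n+k)) ^ 2 * (1 + n) * (7/6 + (n+k)) * (11/6 + (2*n+k))
        * (17/6 + (2*n+k)))) * Q (n+1) k - Q n k := by
  have e1 : 1 + 2 * n + (k+1) = 2 + (2*n+k) := by ring
  have e2 : 1 + 2 * n + k = 1 + (2*n+k) := by ring
  rw [e1, e2]
  have d1 : 1 + (2*n+k) ≠ 0 := by positivity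
  have d2 : 2 + (2*n+k) ≠ 0 := by positivity
  have d3 : 1 + n ≠ 0 := by positivity
  have d4 : 7/6 + (n+k) ≠ 0 := by positivity
  have d5 : 11/6 + (2*n+k) ≠ 0 := by positivity
  have d6 : 17/6 + (2*n+k) ≠ 0 := by positivity
  have d4' : 7 + 6 * (n+k) ≠ 0 := by positivity
  have d5' : 11 + 6 * (2*n+k) ≠ 0 := by positivity
  have d6' : 17 + 6 * (2*n+k) ≠ 0 := by positivity
  unfold P Q
  field_simp
  ring

lemma wz (n k : ℕ) : F n (k+1) - F n k = G (n+1) k - G n k := by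
  have h := wz_rat n k (by positivity) (by positivity)
  unfold F G
  rw [H_succ_right, H_succ_left]
  push_cast
  linear_combination (H n k) * h

/-- Partial sums. -/
noncomputable def S (N k : ℕ) : ℝ := ∑ n ∈ range N, F n k

lemma G_zero (k : ℕ) : G 0 k = 0 := by simp [G, Q]

lemma S_step (N k : ℕ) : S N (k+1) = S N k + G N k := by
  have : S N (k+1) - S N k = G N k := by
    unfold S
    rw [← Finset.sum_sub_distrib]
    simp only [wz]
    rw [Finset.sum_range_sub (fun n => G n k), G_zero, sub_zero]
  linarith

lemma S_mono (N : ℕ) : Monotone (S N) :=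
  monotone_nat_of_le_succ fun k => by rw [S_step]; linarith [G_nonneg N k]

lemma poch_gammaSeq {s : ℝ} (hs : 0 < s) (k : ℕ) (hk : 0 < k) :
    poch s k = (k:ℝ) ^ s * (k.factorial : ℝ) / (Real.GammaSeq s k * (s + k)) := by
  have h1 : Real.GammaSeq s k = (k:ℝ) ^ s * (k.factorial : ℝ) / (poch s k * (s + k)) := by
    rw [← poch_succ]; rfl
  have hp := poch_pos hs k
  have hk' : (0:ℝ) < k := by exact_mod_cast hk
  have : (0:ℝ) < (k:ℝ) ^ s := Real.rpow_pos_of_pos hk' s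
  have hf : (0:ℝ) < k.factorial := by exact_mod_cast Nat.factorial_pos k
  rw [h1]
  field_simp

lemma gamma_val : Real.Gamma 1 ^ 2 * Real.Gamma (7/6) * Real.Gamma (11/6) /
    (Real.Gamma (1/3) * Real.Gamma (1/2) ^ 2 * Real.Gamma (2/3)) * 108 = 15 * √3 / π := by
  have a1 : Real.Gamma (7/6) = 1/6 * Real.Gamma (1/6) := by
    rw [← Real.Gamma_add_one (by norm_num)]; norm_num
  have a2 : Real.Gamma (11/6) = 5/6 * Real.Gamma (5/6) := by
    rw [← Real.Gamma_add_one (by norm_num)]; norm_num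
  have b1 : Real.Gamma (1/6) * Real.Gamma (5/6) = 2 * π := by
    have := Real.Gamma_mul_Gamma_one_sub (1/6)
    rw [show (1:ℝ) - 1/6 = 5/6 by norm_num, show π * (1/6) = π / 6 by ring, Real.sin_pi_div_six]
      at this
    rw [this]; ring
  have b2 : Real.Gamma (1/3) * Real.Gamma (2/3) = 2 * π / √3 := by
    have := Real.Gamma_mul_Gamma_one_sub (1/3)
    rw [show (1:ℝ) - 1/3 = 2/3 by norm_num, show π * (1/3) = π / 3 by ring, Real.sin_pi_div_three]
      at this
    rw [this]; field_simp
  have b3 : Real.Gamma (1/2) ^ 2 = π := by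
    rw [Real.Gamma_one_half_eq, Real.sq_sqrt Real.pi_pos.le]
  rw [show Real.Gamma 1 ^ 2 * Real.Gamma (7/6) * Real.Gamma (11/6) =
    5/36 * (Real.Gamma (1/6) * Real.Gamma (5/6)) by rw [a1, a2, Real.Gamma_one]; ring,
    show Real.Gamma (1/3) * Real.Gamma (1/2) ^ 2 * Real.Gamma (2/3) =
    (Real.Gamma (1/3) * Real.Gamma (2/3)) * Real.Gamma (1/2) ^ 2 by ring, b1, b2, b3]
  have := Real.pi_pos
  field_simp
  norm_num

lemma F0_eq (k : ℕ) (hk : 0 < k) : F 0 k =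
    (Real.GammaSeq 1 k ^ 2 * Real.GammaSeq (7/6) k * Real.GammaSeq (11/6) k /
    (Real.GammaSeq (1/3) k * Real.GammaSeq (1/2) k ^ 2 * Real.GammaSeq (2/3) k)) *
    ((fun t : ℝ => (7/6 * t + 1) * (11/6 * t + 1) *
      (8 * t ^ 5 + 74 * t ^ 4 + 263 * t ^ 3 + 447 * t ^ 2 + 360 * t + 108) /
      ((1/3 * t + 1) * (1/2 * t + 1) ^ 2 * (2/3 * t + 1))) ((k:ℝ)⁻¹)) := by
  have hk' : (0:ℝ) < k := by exact_mod_cast hk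
  have hf : (0:ℝ) < k.factorial := by exact_mod_cast Nat.factorial_pos k
  have gp : ∀ s : ℝ, 0 < s → 0 < Real.GammaSeq s k := by
    intro s hs
    have h1 : Real.GammaSeq s k = (k:ℝ) ^ s * (k.factorial : ℝ) / (poch s k * (s + k)) := by
      rw [← poch_succ]; rfl
    have := poch_pos hs k
    have := Real.rpow_pos_of_pos hk' s
    rw [h1]; positivity
  have g1 := gp 1 (by norm_num)
  have g2 := gp (7/6) (by norm_num)
  have g3 := gp (11/6) (by norm_num)
  have g4 := gp (1/3) (by norm_num)
  have g5 := gp (1/2) (by norm_num)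
  have g6 := gp (2/3) (by norm_num)
  have r1 : (k:ℝ) ^ (7/6:ℝ) * (k:ℝ) ^ (11/6:ℝ) = (k:ℝ) ^ 3 := by
    rw [← Real.rpow_add hk', ← Real.rpow_natCast]; norm_num
  have r2 : (k:ℝ) ^ (1/3:ℝ) * (k:ℝ) ^ (2/3:ℝ) = (k:ℝ) := by
    rw [← Real.rpow_add hk']; norm_num
  have r3 : ((k:ℝ) ^ (1/2:ℝ)) ^ 2 = (k:ℝ) := by
    rw [← Real.rpow_natCast, ← Real.rpow_mul hk'.le]; norm_num
  have hH : H 0 k = (Real.GammaSeq 1 k ^ 2 * Real.GammaSeq (7/6) k * Real.GammaSeq (11/6) k /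
    (Real.GammaSeq (1/3) k * Real.GammaSeq (1/2) k ^ 2 * Real.GammaSeq (2/3) k)) *
    ((1 + k) ^ 2 * (7/6 + k) * (11/6 + k) / (k ^ 3 * ((1/3 + k) * (1/2 + k) ^ 2 * (2/3 + k)))) := by
    unfold H
    simp only [mul_zero, zero_add, poch_zero]
    rw [poch_gammaSeq (s := 1/3) (by norm_num) k hk, poch_gammaSeq (s := 1/2) (by norm_num) k hk,
      poch_gammaSeq (s := 2/3) (by norm_num) k hk, poch_gammaSeq (s := 1) (by norm_num) k hk,
      poch_gammaSeq (s := 7/6) (by norm_num) k hk, poch_gammaSeq (s := 11/6) (by norm_num) k hk]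
    have p1 := Real.rpow_pos_of_pos hk' (1/3)
    have p2 := Real.rpow_pos_of_pos hk' (2/3)
    have p3 := Real.rpow_pos_of_pos hk' (1/2)
    have p4 := Real.rpow_pos_of_pos hk' (7/6)
    have p5 := Real.rpow_pos_of_pos hk' (11/6)
    rw [Real.rpow_one]
    generalize (k:ℝ) ^ (7/6:ℝ) = x1 at *
    generalize (k:ℝ) ^ (11/6:ℝ) = x2 at *
    generalize (k:ℝ) ^ (1/3:ℝ) = x3 at *
    generalize (k:ℝ) ^ (2/3:ℝ) = x4 at *
    generalize (k:ℝ) ^ (1/2:ℝ) = x5 at *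
    generalize Real.GammaSeq 1 k = y1 at *
    generalize Real.GammaSeq (7/6) k = y2 at *
    generalize Real.GammaSeq (11/6) k = y3 at *
    generalize Real.GammaSeq (1/3) k = y4 at *
    generalize Real.GammaSeq (1/2) k = y5 at *
    generalize Real.GammaSeq (2/3) k = y6 at *
    generalize (k.factorial : ℝ) = f at *
    generalize (k : ℝ) = κ at *
    have l : (x3 * f / (y4 * (1/3 + κ)) * 1 ^ 2 * (x5 * f / (y5 * (1/2 + κ))) ^ 2 *
        (x4 * f / (y6 * (2/3 + κ))) * 1) =
        (x3 * x4) * x5 ^ 2 * f ^ 4 /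
          (y4 * y5 ^ 2 * y6 * ((1/3 + κ) * (1/2 + κ) ^ 2 * (2/3 + κ))) := by
      field_simp
    have r : ((κ * f / (y1 * (1 + κ))) ^ 2 * 1 * (x1 * f / (y2 * (7/6 + κ))) *
        (x2 * f / (y3 * (11/6 + κ)))) =
        κ ^ 2 * (x1 * x2) * f ^ 4 /
          (y1 ^ 2 * y2 * y3 * ((1 + κ) ^ 2 * (7/6 + κ) * (11/6 + κ))) := by
      field_simp
    rw [l, r, r1, r2, r3]
    field_simp
  unfold F
  rw [hH, mul_assoc]
  congr 1
  unfold P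
  simp only [Nat.cast_zero]
  generalize (k : ℝ) = κ at *
  field_simp
  ring

lemma F0_tendsto : Tendsto (fun k => F 0 k) atTop (𝓝 (15 * √3 / π)) := by
  have hg : ∀ s : ℝ, Tendsto (Real.GammaSeq s) atTop (𝓝 (Real.Gamma s)) :=
    Real.GammaSeq_tendsto_Gamma
  have n1 : Real.Gamma (1/3) ≠ 0 := (Real.Gamma_pos_of_pos (by norm_num)).ne'
  have n2 : Real.Gamma (1/2) ≠ 0 := (Real.Gamma_pos_of_pos (by norm_num)).ne'
  have n3 : Real.Gamma (2/3) ≠ 0 := (Real.Gamma_pos_of_pos (by norm_num)).ne'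
  have h1 := ((((hg 1).pow 2).mul (hg (7/6))).mul (hg (11/6))).div
    (((hg (1/3)).mul ((hg (1/2)).pow 2)).mul (hg (2/3))) (by positivity)
  have hc : ContinuousAt (fun t : ℝ => (7/6 * t + 1) * (11/6 * t + 1) *
      (8 * t ^ 5 + 74 * t ^ 4 + 263 * t ^ 3 + 447 * t ^ 2 + 360 * t + 108) /
      ((1/3 * t + 1) * (1/2 * t + 1) ^ 2 * (2/3 * t + 1))) 0 := by
    apply ContinuousAt.div
    · fun_prop
    · fun_prop
    · norm_num
  have h2 := hc.tendsto.comp (tendsto_inv_atTop_nhds_zero_nat (𝕜 := ℝ))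
  have h3 := h1.mul h2
  rw [← gamma_val]
  refine Tendsto.congr' ?_ (h3.trans_eq ?_)
  · filter_upwards [eventually_gt_atTop 0] with k hk
    rw [F0_eq k hk]; rfl
  · norm_num

lemma F0_le (k : ℕ) : F 0 k ≤ 15 * √3 / π := by
  have hm : Monotone (fun k => F 0 k) := by
    intro i j hij
    have := S_mono 1 hij
    simpa [S] using this
  exact hm.ge_of_tendsto F0_tendsto k

lemma P_le (n k : ℕ) : P n k ≤ 200 * (1 + 2 * n + k) ^ 5 := by
  rw [← sub_nonneg]
  unfold P
  ring_nf
  positivity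

lemma P_ge (k : ℕ) : 8 * (1 + k) ^ 5 ≤ P 0 k := by
  rw [← sub_nonneg]
  unfold P
  ring_nf
  positivity

lemma H_step_le (n k : ℕ) : H (n+1) k ≤ H n k * ((n + 1) ^ 2 / (1 + k)) := by
  rw [H_succ_left]
  apply mul_le_mul_of_nonneg_left _ (H_pos n k).le
  rw [div_le_div_iff₀ (by positivity) (by positivity), ← sub_nonneg]
  ring_nf
  positivity

lemma H_bound (n : ℕ) : ∃ C : ℝ, 0 ≤ C ∧ ∀ k : ℕ, H n k * (1 + k) ^ 3 ≤ C := by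
  induction n with
  | zero =>
    refine ⟨15 * √3 / π / 8, by positivity, fun k => ?_⟩
    have h1 := F0_le k
    have h2 := P_ge k
    have h3 := H_pos 0 k
    have h4 : H 0 k * (8 * (1 + k) ^ 3) ≤ F 0 k := by
      unfold F
      apply mul_le_mul_of_nonneg_left _ h3.le
      rw [le_div_iff₀ (by positivity)]
      simp only [Nat.cast_zero, mul_zero, add_zero]
      calc _ = 8 * (1 + (k:ℝ)) ^ 5 := by ring
        _ ≤ _ := h2
    linarith
  | succ n ih =>
    obtain ⟨C, hC, h⟩ := ih
    refine ⟨C * (n + 1) ^ 2, by positivity, fun k => ?_⟩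
    have h1 := H_step_le n k
    have h2 : ((n:ℝ) + 1) ^ 2 / (1 + k) ≤ (n + 1) ^ 2 :=
      div_le_self (by positivity) (by linarith [Nat.cast_nonneg (α := ℝ) k])
    calc H (n+1) k * (1 + k) ^ 3 ≤ H n k * ((n + 1) ^ 2 / (1 + k)) * (1 + k) ^ 3 := by gcongr
      _ = H n k * (1 + k) ^ 3 * ((n + 1) ^ 2 / (1 + k)) := by ring
      _ ≤ C * (n + 1) ^ 2 := mul_le_mul (h k) h2 (by positivity) hC

lemma F_succ_tendsto (n : ℕ) : Tendsto (fun k => F (n+1) k) atTop (𝓝 0) := by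
  obtain ⟨C, hC, h⟩ := H_bound n
  have hlim : Tendsto (fun k : ℕ => (200 * (3 + 2 * (n:ℝ)) ^ 3 * C * (n+1) ^ 2) * (1 / ((k:ℝ) + 1)))
      atTop (𝓝 0) := by
    have := (tendsto_one_div_add_atTop_nhds_zero_nat (𝕜 := ℝ)).const_mul
      (200 * (3 + 2 * (n:ℝ)) ^ 3 * C * (n+1) ^ 2)
    simpa using this
  refine squeeze_zero (fun k => F_nonneg _ _) (fun k => ?_) hlim
  have h1 := H_step_le n k
  have hp := P_le (n+1) k
  have h2 : P ((n+1 : ℕ) : ℝ) k / (1 + 2 * ((n+1 : ℕ) : ℝ) + k) ^ 2 ≤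
      200 * ((3 + 2 * n) * (1 + k)) ^ 3 := by
    rw [div_le_iff₀ (by positivity)]
    refine hp.trans ?_
    have h3 : (1 + 2 * ((n+1 : ℕ) : ℝ) + k) ≤ (3 + 2 * n) * (1 + k) := by
      rw [← sub_nonneg]; push_cast; ring_nf; positivity
    calc 200 * (1 + 2 * ((n+1 : ℕ) : ℝ) + k) ^ 5
        = 200 * (1 + 2 * ((n+1 : ℕ) : ℝ) + k) ^ 3 * (1 + 2 * ((n+1 : ℕ) : ℝ) + k) ^ 2 := by ring
      _ ≤ _ := by gcongr
  have hH := H_pos n k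
  calc F (n+1) k ≤ H n k * ((n + 1) ^ 2 / (1 + k)) * (200 * ((3 + 2 * n) * (1 + k)) ^ 3) := by
        unfold F
        apply mul_le_mul h1 h2
        · have := P_nonneg (n+1) k
          positivity
        · positivity
    _ = (H n k * (1 + k) ^ 3) * (200 * (3 + 2 * (n:ℝ)) ^ 3 * (n+1) ^ 2 * (1 / ((k:ℝ) + 1))) := by
        rw [add_comm (k:ℝ) 1]; ring
    _ ≤ C * (200 * (3 + 2 * (n:ℝ)) ^ 3 * (n+1) ^ 2 * (1 / ((k:ℝ) + 1))) := by
        gcongr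
        exact h k
    _ = _ := by ring

lemma S_tendsto (N : ℕ) : Tendsto (fun k => S (N+1) k) atTop (𝓝 (15 * √3 / π)) := by
  have h : ∀ k, S (N+1) k = ∑ n ∈ range N, F (n+1) k + F 0 k := fun k => by
    unfold S; rw [Finset.sum_range_succ']
  simp only [h]
  have h1 : Tendsto (fun k => ∑ n ∈ range N, F (n+1) k) atTop (𝓝 (∑ n ∈ range N, (0:ℝ))) :=
    tendsto_finsetSum _ fun n _ => F_succ_tendsto n
  simpa using h1.add F0_tendsto

lemma S_le (N k : ℕ) : S N k ≤ 15 * √3 / π := by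
  have h1 : S N k ≤ S (N+1) k := by
    unfold S; rw [Finset.sum_range_succ]; linarith [F_nonneg N k]
  exact h1.trans ((S_mono (N+1)).ge_of_tendsto (S_tendsto N) k)

lemma F_summable (k : ℕ) : Summable (fun n => F n k) :=
  summable_of_sum_range_le (fun n => F_nonneg n k) (fun N => S_le N k)

lemma G_le (n k : ℕ) : G n k ≤ 10 * F n k := by
  unfold G F
  have := H_pos n k
  have h : Q n k ≤ 10 * (P n k / (1 + 2 * n + k) ^ 2) := by
    rw [← mul_div_assoc, le_div_iff₀ (by positivity), ← sub_nonneg]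
    unfold P Q
    ring_nf
    positivity
  calc H n k * Q n k ≤ H n k * (10 * (P n k / (1 + 2 * n + k) ^ 2)) := by gcongr
    _ = _ := by ring

lemma G_tendsto (k : ℕ) : Tendsto (fun n => G n k) atTop (𝓝 0) := by
  refine squeeze_zero (fun n => G_nonneg n k) (fun n => G_le n k) ?_
  simpa using (F_summable k).tendsto_atTop_zero.const_mul 10

lemma tsum_const (k : ℕ) : ∑' n, F n k = ∑' n, F n 0 := by
  induction k with
  | zero => rfl
  | succ k ih =>
    rw [← ih]
    have h1 := (F_summable (k+1)).hasSum.tendsto_sum_nat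
    have h2 := ((F_summable k).hasSum.tendsto_sum_nat).add (G_tendsto k)
    rw [add_zero] at h2
    refine tendsto_nhds_unique h1 (h2.congr fun N => ?_)
    exact (S_step N k).symm

lemma tsum_F : ∑' n, F n 0 = 15 * √3 / π := by
  apply le_antisymm
  · exact (F_summable 0).tsum_le_of_sum_range_le (fun N => S_le N 0)
  · refine le_of_tendsto F0_tendsto (Eventually.of_forall fun k => ?_)
    rw [← tsum_const k]
    exact (F_summable k).le_tsum 0 (fun n _ => F_nonneg n k)

lemma F_zero_right (n : ℕ) : F n 0 = (1 / 16 ^ n) *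
      (poch (1/2) n * poch (1/3) n ^ 2 * poch (2/3) n ^ 2 /
        (poch 1 n ^ 3 * poch (11/12) n * poch (17/12) n)) *
      (135 * (n : ℝ) ^ 2 + 75 * n + 8) := by
  have e1 : poch (1/3) (2 * n) = 4 ^ n * poch (1/6) n * poch (2/3) n := by
    rw [poch_double]; norm_num
  have e2 : poch 1 (2 * n) = 4 ^ n * poch (1/2) n * poch 1 n := by
    rw [poch_double]; norm_num
  have e3 : poch (11/6) (2 * n) = 4 ^ n * poch (11/12) n * poch (17/12) n := by
    rw [poch_double]; norm_num
  have e4 : poch (7/6) n = 6 * (poch (1/6) n * (1/6 + n)) := by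
    have := poch_shift (1/6) n
    rw [← this, show (1/6 + 1 : ℝ) = 7/6 by norm_num]; ring
  have e5 : (16:ℝ) ^ n = 4 ^ n * 4 ^ n := by rw [← mul_pow]; norm_num
  have hP : P n 0 = 6 * (1/6 + n) * (135 * (n : ℝ) ^ 2 + 75 * n + 8) * (1 + 2 * n) ^ 2 := by
    unfold P; ring
  unfold F H
  simp only [add_zero, Nat.cast_zero]
  rw [hP, e1, e2, e3, e4, e5]
  have p1 := poch_pos (x := 1/3) (by norm_num) n
  have p2 := poch_pos (x := 1/2) (by norm_num) n
  have p3 := poch_pos (x := 2/3) (by norm_num) n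
  have p4 := poch_pos (x := 1) (by norm_num) n
  have p5 := poch_pos (x := 1/6) (by norm_num) n
  have p6 := poch_pos (x := 11/12) (by norm_num) n
  have p7 := poch_pos (x := 17/12) (by norm_num) n
  generalize poch (1/3) n = a1 at *
  generalize poch (1/2) n = a2 at *
  generalize poch (2/3) n = a3 at *
  generalize poch 1 n = a4 at *
  generalize poch (1/6) n = a5 at *
  generalize poch (11/12) n = a6 at *
  generalize poch (17/12) n = a7 at *
  have q : (0:ℝ) < 4 ^ n := by positivity
  generalize (4:ℝ) ^ n = z at *
  have q2 : (0:ℝ) < 1/6 + n := by positivity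
  have q3 : (0:ℝ) < 1 + 2 * n := by positivity
  generalize hw : (1/6 + (n:ℝ)) = w at *
  generalize hv : (1 + 2 * (n:ℝ)) = v at *
  field_simp

end WZ

theorem series_15sqrt3_div_pi :
    15 * Real.sqrt 3 / π = ∑' n : ℕ, (1 / 16 ^ n) *
      (poch (1/2) n * poch (1/3) n ^ 2 * poch (2/3) n ^ 2 /
        (poch 1 n ^ 3 * poch (11/12) n * poch (17/12) n)) *
      (135 * (n : ℝ) ^ 2 + 75 * n + 8) := by
  rw [← WZ.tsum_F]
  exact tsum_congr WZ.F_zero_right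
end
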